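/- arXiv:1806.05654 — 7 statements merged into one kernel-verified Lean document; each statement's English description precedes it below -/
import Mathlib

section
/- Let C be a category that is finitely complete, has coequalizers, and in which regular epimorphisms are closed under composition, and let H: C → C be an endofunctor preserving monomorphisms. Then a coalgebra (X, ξ) is simple if and only if every coalgebra morphism with domain (X, ξ) is carried by a monomorphism of C. -/
open CategoryTheory CategoryTheory.Limits CategoryTheory.Endofunctor

universe v u

/-- A coalgebra `(X, ξ)` for an endofunctor `H` is *simple* if every quotient of it, i.e.
every coalgebra morphism with domain `(X, ξ)` whose underlying morphism is a regular
epimorphism, is an isomorphism (of coalgebras). -/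
def CoalgSimple {C : Type u} [Category.{v} C] {H : C ⥤ C}
    (X : Coalgebra H) : Prop :=
  ∀ (Y : Coalgebra H) (h : X ⟶ Y), Nonempty (RegularEpi h.f) → IsIso h

/-- If regular epimorphisms compose, every morphism factors as the coequalizer of its kernel
pair followed by a monomorphism. -/
theorem mono_coequalizer_desc_kernelPair {C : Type u} [Category.{v} C]
    [HasPullbacks C] [HasCoequalizers C]
    (hcomp : ∀ {A B D : C} (f : A ⟶ B) (g : B ⟶ D),
      Nonempty (RegularEpi f) → Nonempty (RegularEpi g) → Nonempty (RegularEpi (f ≫ g)))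
    {A B : C} (f : A ⟶ B) :
    Mono (coequalizer.desc f (pullback.condition (f := f) (g := f))) := by
  set e := coequalizer.π (pullback.fst f f) (pullback.snd f f)
  set m := coequalizer.desc f (pullback.condition (f := f) (g := f))
  have hem : e ≫ m = f := coequalizer.π_desc _ _
  set e' := coequalizer.π (pullback.fst m m) (pullback.snd m m)
  set m' := coequalizer.desc m (pullback.condition (f := m) (g := m))
  have hem' : e' ≫ m' = m := coequalizer.π_desc _ _
  obtain ⟨r⟩ := hcomp e e' ⟨IsRegularEpi.getStruct e⟩ ⟨IsRegularEpi.getStruct e'⟩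
  have hf : r.left ≫ f = r.right ≫ f := by
    have hfac : (e ≫ e') ≫ m' = f := by rw [Category.assoc, hem', hem]
    calc r.left ≫ f = (r.left ≫ e ≫ e') ≫ m' := by rw [Category.assoc, hfac]
      _ = (r.right ≫ e ≫ e') ≫ m' := by rw [r.w]
      _ = r.right ≫ f := by rw [Category.assoc, hfac]
  have he : r.left ≫ e = r.right ≫ e := by
    have := pullback.lift r.left r.right hf ≫=
      coequalizer.condition (pullback.fst f f) (pullback.snd f f)
    rwa [pullback.lift_fst_assoc, pullback.lift_snd_assoc] at this
  obtain ⟨s, hs⟩ := Cofork.IsColimit.desc' r.isColimit e he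
  have hs' : e' ≫ s = 𝟙 _ := by
    rw [← cancel_epi e]
    simpa using hs
  have hk : pullback.fst m m = pullback.snd m m := by
    have := coequalizer.condition (pullback.fst m m) (pullback.snd m m) =≫ s
    simpa only [Category.assoc, e', hs', Category.comp_id] using this
  refine ⟨fun a b hab => ?_⟩
  have := pullback.lift a b hab ≫= hk
  rwa [pullback.lift_fst, pullback.lift_snd] at this

/-- Let `C` be finitely complete with coequalizers, in which regular epimorphisms are closed
under composition, and let `H : C ⥤ C` preserve monomorphisms.  Then a coalgebra `(X, ξ)`
is simple iff every coalgebra morphism with domain `(X, ξ)` is carried by a monomorphism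
of `C`. -/
theorem simple_iff_mono {C : Type u} [Category.{v} C]
    [HasFiniteLimits C] [HasCoequalizers C]
    (hcomp : ∀ {A B D : C} (f : A ⟶ B) (g : B ⟶ D),
      Nonempty (RegularEpi f) → Nonempty (RegularEpi g) → Nonempty (RegularEpi (f ≫ g)))
    (H : C ⥤ C) [H.PreservesMonomorphisms]
    (X : Coalgebra H) :
    CoalgSimple X ↔ ∀ (Y : Coalgebra H) (h : X ⟶ Y), Mono h.f := by
  constructor
  · intro hX Y h
    have hmono := mono_coequalizer_desc_kernelPair hcomp h.f
    set p := pullback.fst h.f h.f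
    set q := pullback.snd h.f h.f
    set m := coequalizer.desc h.f (pullback.condition (f := h.f) (g := h.f))
    have hpq : p ≫ h.f = q ≫ h.f := pullback.condition
    have hem : coequalizer.π p q ≫ m = h.f := coequalizer.π_desc _ _
    have hstr : p ≫ X.str ≫ H.map (coequalizer.π p q) =
        q ≫ X.str ≫ H.map (coequalizer.π p q) := by
      rw [← cancel_mono (H.map m)]
      simp only [Category.assoc, ← H.map_comp, hem, h.h]
      rw [reassoc_of% hpq]
    let Q : Coalgebra H := ⟨coequalizer p q, coequalizer.desc _ hstr⟩
    let e : X ⟶ Q := { f := coequalizer.π p q, h := (coequalizer.π_desc _ hstr).symm }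
    have : IsIso e := hX Q e ⟨IsRegularEpi.getStruct (coequalizer.π p q)⟩
    have : IsIso (coequalizer.π p q) := inferInstanceAs (IsIso ((Coalgebra.forget H).map e))
    rw [← hem]
    infer_instance
  · rintro hX Y h ⟨r⟩
    have := hX Y h
    have : IsIso h.f := isIso_of_regularEpi_of_mono h.f r
    exact Coalgebra.iso_of_iso h
end

section
/- Let C be a category that is finitely complete, has coequalizers, and in which regular epimorphisms are closed under composition, and let H: C → C be an endofunctor. If e₁: (X, ξ) ↠ (Y₁, ζ₁) and e₂: (X, ξ) ↠ (Y₂, ζ₂) are quotients of the coalgebra (X, ξ) such that (Y₁, ζ₁) and (Y₂, ζ₂) are simple, then e₁ and e₂ represent the same quotient: there is an isomorphism of coalgebras j: (Y₁, ζ₁) ≅ (Y₂, ζ₂) with j∘e₁ = e₂. -/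
open CategoryTheory CategoryTheory.Limits CategoryTheory.Endofunctor

universe v u

/-- A regular epimorphism has a pushout along every morphism with the same domain, as soon as
coequalizers exist. -/
theorem exists_isPushout_of_regularEpi {C : Type u} [Category.{v} C] [HasCoequalizers C]
    {X Y Z : C} (f : X ⟶ Y) (g : X ⟶ Z) (hf : RegularEpi f) :
    ∃ (P : C) (inl : Y ⟶ P) (inr : Z ⟶ P), IsPushout f g inl inr := by
  have hw : hf.left ≫ g ≫ coequalizer.π (hf.left ≫ g) (hf.right ≫ g) =
      hf.right ≫ g ≫ coequalizer.π (hf.left ≫ g) (hf.right ≫ g) := by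
    simpa using coequalizer.condition (hf.left ≫ g) (hf.right ≫ g)
  have hepi : Epi f := hf.epi
  let inl := Cofork.IsColimit.desc hf.isColimit _ hw
  have hinl : f ≫ inl = g ≫ coequalizer.π (hf.left ≫ g) (hf.right ≫ g) :=
    Cofork.IsColimit.π_desc' hf.isColimit _ hw
  refine ⟨_, inl, coequalizer.π (hf.left ≫ g) (hf.right ≫ g), ⟨⟨hinl⟩, ⟨?_⟩⟩⟩
  refine PushoutCocone.IsColimit.mk _
    (fun s => coequalizer.desc s.inr ?_) (fun s => ?_) (fun s => ?_) (fun s m _ hm => ?_)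
  · rw [Category.assoc, Category.assoc, ← s.condition, reassoc_of% hf.w]
  · rw [← cancel_epi f, reassoc_of% hinl, coequalizer.π_desc, s.condition]
  · exact coequalizer.π_desc _ _
  · rw [← cancel_epi (coequalizer.π (hf.left ≫ g) (hf.right ≫ g)), hm, coequalizer.π_desc]

/-- A pushout of the morphisms underlying two coalgebra morphisms carries a coalgebra structure
making both coprojections coalgebra morphisms. -/
theorem exists_coalgebra_of_isPushout {C : Type u} [Category.{v} C] {H : C ⥤ C}
    {X Y Z : Coalgebra H} (f : X ⟶ Y) (g : X ⟶ Z) {P : C} {inl : Y.V ⟶ P} {inr : Z.V ⟶ P}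
    (h : IsPushout f.f g.f inl inr) :
    ∃ (Q : Coalgebra H) (i : Y ⟶ Q) (k : Z ⟶ Q),
      f ≫ i = g ≫ k ∧ IsPushout f.f g.f i.f k.f := by
  have hw : f.f ≫ Y.str ≫ H.map inl = g.f ≫ Z.str ≫ H.map inr := by
    rw [← f.h_assoc, ← g.h_assoc, ← H.map_comp, ← H.map_comp, h.w]
  refine ⟨⟨P, h.desc _ _ hw⟩, ⟨inl, (h.inl_desc _ _ hw).symm⟩, ⟨inr, (h.inr_desc _ _ hw).symm⟩,
    ?_, h⟩
  ext
  exact h.w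

/-- **Uniqueness of simple quotients.**  Let `C` be finitely complete with coequalizers, in
which regular epimorphisms are closed under composition, and let `H : C ⥤ C` be an
endofunctor. If `e₁ : (X, ξ) ↠ (Y₁, ζ₁)` and `e₂ : (X, ξ) ↠ (Y₂, ζ₂)` are quotients of the
coalgebra `(X, ξ)` with `(Y₁, ζ₁)` and `(Y₂, ζ₂)` simple, then `e₁` and `e₂` represent the
same quotient: there is an isomorphism of coalgebras `j : Y₁ ≅ Y₂` with `e₁ ≫ j.hom = e₂`. -/
theorem simple_quotient_unique {C : Type u} [Category.{v} C]
    [HasFiniteLimits C] [HasCoequalizers C]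
    (hcomp : ∀ {A B D : C} (f : A ⟶ B) (g : B ⟶ D),
      Nonempty (RegularEpi f) → Nonempty (RegularEpi g) → Nonempty (RegularEpi (f ≫ g)))
    (H : C ⥤ C)
    (X Y₁ Y₂ : Coalgebra H) (e₁ : X ⟶ Y₁) (e₂ : X ⟶ Y₂)
    (he₁ : Nonempty (RegularEpi e₁.f)) (he₂ : Nonempty (RegularEpi e₂.f))
    (hs₁ : CoalgSimple Y₁) (hs₂ : CoalgSimple Y₂) :
    ∃ j : Y₁ ≅ Y₂, e₁ ≫ j.hom = e₂ := by
  obtain ⟨r₁⟩ := he₁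
  obtain ⟨r₂⟩ := he₂
  obtain ⟨P, inl, inr, hP⟩ := exists_isPushout_of_regularEpi e₁.f e₂.f r₁
  obtain ⟨Q, i, k, hw, hQ⟩ := exists_coalgebra_of_isPushout e₁ e₂ hP
  have hi : IsIso i := hs₁ Q i ⟨regularOfIsPushoutFstOfRegular r₂ hQ.flip.w hQ.flip.isColimit⟩
  have hk : IsIso k := hs₂ Q k ⟨regularOfIsPushoutFstOfRegular r₁ hQ.w hQ.isColimit⟩
  refine ⟨asIso i ≪≫ (asIso k).symm, ?_⟩
  simp [reassoc_of% hw]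
end

section
/- Let C be a category that is finitely complete, has coequalizers, and in which regular epimorphisms are closed under composition, let H, G: C → C be endofunctors, and let m: H → G be a natural transformation all of whose components are monomorphisms. Let ξ: X → HX be an H-coalgebra. Then for every regular epimorphism q: X → Y of C, there exists ζ: Y → HY making q an H-coalgebra morphism (X, ξ) → (Y, ζ) if and only if there exists ζ': Y → GY making q a G-coalgebra morphism (X, m_X∘ξ) → (Y, ζ'). In particular, (X, ξ) and (X, m_X∘ξ) have the same quotients. -/
open CategoryTheory CategoryTheory.Limits

universe v u

/-- **Reduction along a componentwise-monic natural transformation.**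
Let `C` be finitely complete with coequalizers, in which regular epimorphisms are closed
under composition, let `H, G : C ⥤ C` be endofunctors and `m : H ⟶ G` a natural
transformation all of whose components are monomorphisms.  Let `ξ : X ⟶ HX` be an
`H`-coalgebra.  Then for every regular epimorphism `q : X ⟶ Y` there exists
`ζ : Y ⟶ HY` making `q` an `H`-coalgebra morphism `(X, ξ) → (Y, ζ)` iff there exists
`ζ' : Y ⟶ GY` making `q` a `G`-coalgebra morphism `(X, m_X ∘ ξ) → (Y, ζ')`.
In particular, the two coalgebras have the same quotients. -/
theorem coalgebra_reduction {C : Type u} [Category.{v} C]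
    [HasFiniteLimits C] [HasCoequalizers C]
    (hcomp : ∀ {A B D : C} (f : A ⟶ B) (g : B ⟶ D),
      Nonempty (RegularEpi f) → Nonempty (RegularEpi g) → Nonempty (RegularEpi (f ≫ g)))
    (H G : C ⥤ C) (m : H ⟶ G) (hm : ∀ Z : C, Mono (m.app Z))
    (X : C) (ξ : X ⟶ H.obj X)
    (Y : C) (q : X ⟶ Y) (hq : Nonempty (RegularEpi q)) :
    (∃ ζ : Y ⟶ H.obj Y, ξ ≫ H.map q = q ≫ ζ) ↔
      (∃ ζ' : Y ⟶ G.obj Y, (ξ ≫ m.app X) ≫ G.map q = q ≫ ζ') := by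
  constructor
  · rintro ⟨ζ, h⟩
    refine ⟨ζ ≫ m.app Y, ?_⟩
    rw [Category.assoc, ← m.naturality, reassoc_of% h]
  · rintro ⟨ζ', h⟩
    obtain ⟨r⟩ := hq
    have : Mono (m.app Y) := hm Y
    have hζ : r.left ≫ ξ ≫ H.map q = r.right ≫ ξ ≫ H.map q := by
      rw [← cancel_mono (m.app Y)]
      have hq' : (ξ ≫ H.map q) ≫ m.app Y = q ≫ ζ' := by
        rw [← h, Category.assoc, Category.assoc, m.naturality]
      rw [Category.assoc r.left, Category.assoc r.right, hq', reassoc_of% r.w]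
    exact ⟨Cofork.IsColimit.desc r.isColimit _ hζ,
      (Cofork.IsColimit.π_desc' r.isColimit _ hζ).symm⟩
end

section
/- Let C be a category that is finitely complete, has coequalizers, and in which regular epimorphisms are closed under composition, let H: C → C be an endofunctor preserving monomorphisms, let ξ: X → HX be a coalgebra, and let q̄: X → K be any morphism. Let κ_Q: X ↠ X/Q be the coequalizer of the kernel pair of q̄, and let κ_P: X ↠ X/P be the coequalizer of the kernel pair of H(q̄)∘ξ. Then there exists a unique morphism d: X/P → H(X/Q) with d∘κ_P = H(κ_Q)∘ξ, and d is a monomorphism. -/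
open CategoryTheory CategoryTheory.Limits

universe v u

/-- If regular epimorphisms are closed under composition, then every morphism factors as the
coequalizer of its kernel pair followed by a monomorphism. -/
theorem mono_desc_coequalizer_kernelPair {C : Type u} [Category.{v} C]
    [HasFiniteLimits C] [HasCoequalizers C]
    (hcomp : ∀ {A B D : C} (f : A ⟶ B) (g : B ⟶ D),
      Nonempty (RegularEpi f) → Nonempty (RegularEpi g) → Nonempty (RegularEpi (f ≫ g)))
    {X Y : C} (f : X ⟶ Y) : Mono (coequalizer.desc f pullback.condition) := by
  set κ := coequalizer.π (pullback.fst f f) (pullback.snd f f)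
  set m := coequalizer.desc f pullback.condition
  let e := coequalizer.π (pullback.fst m m) (pullback.snd m m)
  have hκm : κ ≫ m = f := coequalizer.π_desc _ _
  have hem : e ≫ coequalizer.desc m pullback.condition = m := coequalizer.π_desc _ _
  have : IsRegularEpi (κ ≫ e) := ⟨hcomp κ e ⟨IsRegularEpi.getStruct _⟩ ⟨IsRegularEpi.getStruct _⟩⟩
  have hf : IsRegularEpi.left (κ ≫ e) ≫ f = IsRegularEpi.right (κ ≫ e) ≫ f := by
    have h := IsRegularEpi.w (κ ≫ e) =≫ coequalizer.desc m pullback.condition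
    simpa only [Category.assoc, hem, hκm] using h
  have hw : IsRegularEpi.left (κ ≫ e) ≫ κ = IsRegularEpi.right (κ ≫ e) ≫ κ := by
    have h := pullback.lift _ _ hf ≫= coequalizer.condition (pullback.fst f f) (pullback.snd f f)
    simpa only [pullback.lift_fst_assoc, pullback.lift_snd_assoc] using h
  have hr : e ≫ IsRegularEpi.desc (κ ≫ e) κ hw = 𝟙 _ := by
    rw [← cancel_epi κ, ← Category.assoc, IsRegularEpi.fac, Category.comp_id]
  have : Mono e := mono_of_mono_fac hr
  refine (IsKernelPair.of_hasPullback m).mono_of_eq_fst_snd ?_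
  rw [← cancel_mono e]
  exact coequalizer.condition _ _

/-- **The structure morphism `ξ/Q` is monic.**
Let `C` be finitely complete with coequalizers, in which regular epimorphisms are closed
under composition, let `H : C ⥤ C` preserve monomorphisms, let `ξ : X ⟶ HX` be a coalgebra
and `qbar : X ⟶ K` any morphism.  Let `κ_Q : X ↠ X/Q` be the coequalizer of the kernel pair
of `qbar` and `κ_P : X ↠ X/P` the coequalizer of the kernel pair of `H qbar ∘ ξ`.  Then there
is a unique `d : X/P ⟶ H(X/Q)` with `d ∘ κ_P = H κ_Q ∘ ξ`, and `d` is a monomorphism. -/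
theorem quotient_structure_mono {C : Type u} [Category.{v} C]
    [HasFiniteLimits C] [HasCoequalizers C]
    (hcomp : ∀ {A B D : C} (f : A ⟶ B) (g : B ⟶ D),
      Nonempty (RegularEpi f) → Nonempty (RegularEpi g) → Nonempty (RegularEpi (f ≫ g)))
    (H : C ⥤ C) [H.PreservesMonomorphisms]
    (X : C) (ξ : X ⟶ H.obj X) (K : C) (qbar : X ⟶ K) :
    ∃ d : coequalizer (pullback.fst (ξ ≫ H.map qbar) (ξ ≫ H.map qbar))
            (pullback.snd (ξ ≫ H.map qbar) (ξ ≫ H.map qbar)) ⟶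
          H.obj (coequalizer (pullback.fst qbar qbar) (pullback.snd qbar qbar)),
      (coequalizer.π _ _ ≫ d = ξ ≫ H.map (coequalizer.π _ _)) ∧
      Mono d ∧
      (∀ d', coequalizer.π _ _ ≫ d' = ξ ≫ H.map (coequalizer.π _ _) → d' = d) := by
  have := mono_desc_coequalizer_kernelPair hcomp qbar
  have := mono_desc_coequalizer_kernelPair hcomp (ξ ≫ H.map qbar)
  have hfac : H.map (coequalizer.π (pullback.fst qbar qbar) (pullback.snd qbar qbar)) ≫
      H.map (coequalizer.desc qbar pullback.condition) = H.map qbar := by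
    rw [← H.map_comp, coequalizer.π_desc]
  have hw : pullback.fst (ξ ≫ H.map qbar) (ξ ≫ H.map qbar) ≫ ξ ≫
        H.map (coequalizer.π (pullback.fst qbar qbar) (pullback.snd qbar qbar)) =
      pullback.snd (ξ ≫ H.map qbar) (ξ ≫ H.map qbar) ≫ ξ ≫
        H.map (coequalizer.π (pullback.fst qbar qbar) (pullback.snd qbar qbar)) := by
    rw [← cancel_mono (H.map (coequalizer.desc qbar pullback.condition))]
    simpa only [Category.assoc, hfac] using pullback.condition
  refine ⟨coequalizer.desc _ hw, coequalizer.π_desc _ _, ?_, fun d' hd' => ?_⟩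
  · have hd : coequalizer.desc _ hw ≫ H.map (coequalizer.desc qbar pullback.condition) =
        coequalizer.desc (ξ ≫ H.map qbar) pullback.condition := by
      ext
      simp only [coequalizer.π_desc_assoc, coequalizer.π_desc, Category.assoc, hfac]
    exact mono_of_mono_fac hd
  · ext
    rw [hd', coequalizer.π_desc]
end

section
/- Let C be an extensive category with finite coproducts that is finitely complete, has coequalizers, and in which regular epimorphisms are closed under composition; let n be a natural number and let H: Cⁿ → Cⁿ be a functor preserving monomorphisms. Let ξ: X → HX be an H-coalgebra in Cⁿ and let η_X: X → Δ∐X be the morphism whose i-th component is the i-th coproduct injection X_i → X₁+⋯+X_n. Then for every regular epimorphism q: X → Y in Cⁿ, q carries an H-coalgebra morphism with domain (X, ξ) if and only if q carries an (H∘Δ∘∐)-coalgebra morphism with domain (X, H(η_X)∘ξ); in particular the two coalgebras have the same quotients and the same simple quotient. -/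
open CategoryTheory CategoryTheory.Limits

universe v u

theorem mono_pi_of_forall_mono {ι : Type*} {C : ι → Type*} [∀ i, Category (C i)]
    {X Y : ∀ i, C i} (f : X ⟶ Y) (hf : ∀ i, Mono (f i)) : Mono f where
  right_cancellation g h w := by
    funext i
    exact (cancel_mono (f i)).1 (congrFun w i)

/-- **De-sorting preserves and reflects quotients.**
Let `C` be an extensive category with finite coproducts that is finitely complete, has
coequalizers, and in which regular epimorphisms are closed under composition; let
`H : Cⁿ ⥤ Cⁿ` preserve monomorphisms.  Let `ξ : X ⟶ HX` be an `H`-coalgebra in `Cⁿ` and let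
`η_X : X ⟶ Δ∐X` be given componentwise by the coproduct injections.  Then for every regular
epimorphism `q : X ⟶ Y` in `Cⁿ`, `q` carries an `H`-coalgebra morphism with domain `(X, ξ)`
iff `q` carries an `(H ∘ Δ ∘ ∐)`-coalgebra morphism with domain `(X, H(η_X) ∘ ξ)`. -/
theorem desorting_same_quotients {C : Type u} [Category.{v} C]
    [FinitaryExtensive C] [HasFiniteCoproducts C]
    [HasFiniteLimits C] [HasCoequalizers C]
    (hcomp : ∀ {A B D : C} (f : A ⟶ B) (g : B ⟶ D),
      Nonempty (RegularEpi f) → Nonempty (RegularEpi g) → Nonempty (RegularEpi (f ≫ g)))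
    (n : ℕ) (H : (Fin n → C) ⥤ (Fin n → C)) [H.PreservesMonomorphisms]
    (X : Fin n → C) (ξ : X ⟶ H.obj X)
    (Y : Fin n → C) (q : X ⟶ Y) (hq : Nonempty (RegularEpi q)) :
    (∃ ζ : Y ⟶ H.obj Y, ξ ≫ H.map q = q ≫ ζ) ↔
      (∃ ζ' : Y ⟶ H.obj (fun _ => ∐ fun i => Y i),
        (ξ ≫ H.map ((fun i => Sigma.ι (fun j => X j) i) :
            X ⟶ (fun _ => ∐ fun j => X j))) ≫
          H.map ((fun _ => Limits.Sigma.map fun i => q i) :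
            ((fun _ => ∐ fun j => X j) : Fin n → C) ⟶ (fun _ => ∐ fun j => Y j)) =
        q ≫ ζ') := by
  have hη : Mono ((fun i => Sigma.ι (fun j => Y j) i) : Y ⟶ (fun _ => ∐ fun j => Y j)) :=
    mono_pi_of_forall_mono _ fun i => inferInstanceAs (Mono (Sigma.ι (fun j => Y j) i))
  have hnat : ((fun i => Sigma.ι (fun j => X j) i) : X ⟶ (fun _ => ∐ fun j => X j)) ≫
      ((fun _ => Limits.Sigma.map fun i => q i) :
        ((fun _ => ∐ fun j => X j) : Fin n → C) ⟶ (fun _ => ∐ fun j => Y j)) =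
      q ≫ ((fun i => Sigma.ι (fun j => Y j) i) : Y ⟶ (fun _ => ∐ fun j => Y j)) := by
    funext i
    exact Sigma.ι_map _ i
  rw [Category.assoc, ← H.map_comp, hnat, H.map_comp, ← Category.assoc]
  constructor
  · rintro ⟨ζ, hζ⟩
    exact ⟨ζ ≫ H.map _, by rw [hζ, Category.assoc]⟩
  · rintro ⟨ζ', hζ'⟩
    have : IsRegularEpi q := ⟨hq⟩
    have sq : CommSq (ξ ≫ H.map q) q (H.map _) ζ' := ⟨hζ'⟩
    exact ⟨sq.lift, sq.fac_left.symm⟩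
end

section
/- Let a: Y → A and b: Y → B be functions between sets such that ker a ∪ ker b is an equivalence relation. Then there exist subsets A' ⊆ A and B' ⊆ B, a function q: Y → A' + B', and functions f_A: B' → A∖A' and f_B: A' → B∖B' such that, defining m: A' + B' → A × B by m(inl a') = (a', f_B(a')) and m(inr b') = (f_A(b'), b'), one has m(q(y)) = (a(y), b(y)) for every y ∈ Y. -/
universe u

/-- **Partition of the target of `⟨a, b⟩`.**
Let `a : Y → A` and `b : Y → B` be functions such that `ker a ∪ ker b` is an equivalence
relation.  Then there are subsets `A' ⊆ A`, `B' ⊆ B`, a map `q : Y → A' + B'` and maps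
`f_A : B' → A ∖ A'`, `f_B : A' → B ∖ B'` such that the map `m : A' + B' → A × B` with
`m(inl a') = (a', f_B a')` and `m(inr b') = (f_A b', b')` satisfies
`m (q y) = (a y, b y)` for all `y`. -/
theorem ab_partition {Y A B : Type u} (a : Y → A) (b : Y → B)
    (h : Equivalence (fun y y' : Y => a y = a y' ∨ b y = b y')) :
    ∃ (A' : Set A) (B' : Set B) (q : Y → A' ⊕ B')
      (fA : B' → {x : A // x ∉ A'}) (fB : A' → {x : B // x ∉ B'}),
      ∀ y : Y,
        Sum.elim (fun a' : A' => ((a' : A), ((fB a' : {x : B // x ∉ B'}) : B)))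
          (fun b' : B' => (((fA b' : {x : A // x ∉ A'}) : A), (b' : B))) (q y)
          = (a y, b y) := by
  classical
  -- `P y` says that `b` is constant on the equivalence class of `y`.
  let P : Y → Prop := fun y => ∀ z, (a y = a z ∨ b y = b z) → b z = b y
  have invariant : ∀ {y z}, (a y = a z ∨ b y = b z) → P y → P z := fun hyz hy w hzw =>
    (hy w (h.trans hyz hzw)).trans (hy _ hyz).symm
  have a_const : ∀ {y z}, ¬ P y → b z = b y → a z = a y := by
    intro y z hy hz
    by_contra hne
    refine hy fun w hyw => ?_
    have hzw := h.trans (Or.inr hz) hyw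
    grind
  choose yA hyA using fun x : a '' {y | P y} => x.2
  choose yB hyB using fun x : b '' {y | ¬ P y} => x.2
  refine ⟨a '' {y | P y}, b '' {y | ¬ P y},
    fun y => if hy : P y then Sum.inl ⟨a y, y, hy, rfl⟩ else Sum.inr ⟨b y, y, hy, rfl⟩,
    fun x => ⟨a (yB x), ?_⟩, fun x => ⟨b (yA x), ?_⟩, fun y => ?_⟩
  · rintro ⟨z, hz, hzx⟩
    exact (hyB x).1 (invariant (Or.inl hzx) hz)
  · rintro ⟨z, hz, hzx⟩
    exact hz (invariant (Or.inr hzx.symm) (hyA x).1)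
  · by_cases hy : P y
    · simp only [dif_pos hy, Sum.elim_inl]
      exact Prod.ext rfl (hy _ (Or.inl (hyA ⟨a y, y, hy, rfl⟩).2.symm))
    · simp only [dif_neg hy, Sum.elim_inr]
      exact Prod.ext (a_const hy (hyB ⟨b y, y, hy, rfl⟩).2) rfl
end

section
/- Let C be an extensive category with finite coproducts, let n be a natural number, and let H: Cⁿ → Cⁿ be a functor preserving monomorphisms. Then the lifting of the coproduct functor, i.e. the functor from the category of coalgebras for the endofunctor H∘Δ∘∐ of Cⁿ to the category of coalgebras for the endofunctor ∐∘H∘Δ of C that sends a coalgebra (X, ξ: X → HΔ∐X) to (∐X, ∐ξ: ∐X → ∐HΔ∐X) and a coalgebra morphism h to ∐h, is an equivalence of categories (it is full, faithful and essentially surjective). -/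
open CategoryTheory CategoryTheory.Limits

universe v u

noncomputable section

variable {C : Type u} [Category.{v} C]

/-- The diagonal functor `Δ : C ⥤ Cⁿ`, `Δ(X) = (X, …, X)`. -/
def diagF (n : ℕ) (C : Type u) [Category.{v} C] : C ⥤ (Fin n → C) :=
  Functor.pi' fun _ => 𝟭 C

/-- The coproduct functor `∐ : Cⁿ ⥤ C`, `∐(X₁, …, Xₙ) = X₁ + ⋯ + Xₙ`. -/
def coprodF (n : ℕ) (C : Type u) [Category.{v} C] [HasFiniteCoproducts C] :
    (Fin n → C) ⥤ C :=
  (piEquivalenceFunctorDiscrete (Fin n) C).functor ⋙ colim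

/-- The lifting of the coproduct functor to coalgebras: it sends a coalgebra
`(X, ξ : X ⟶ HΔ∐X)` for the endofunctor `H ∘ Δ ∘ ∐` of `Cⁿ` to the coalgebra
`(∐X, ∐ξ : ∐X ⟶ ∐HΔ∐X)` for the endofunctor `∐ ∘ H ∘ Δ` of `C`, and a coalgebra
morphism `h` to `∐h`. -/
def liftCoprod (n : ℕ) [HasFiniteCoproducts C]
    (H : (Fin n → C) ⥤ (Fin n → C)) :
    Endofunctor.Coalgebra (coprodF n C ⋙ diagF n C ⋙ H) ⥤
      Endofunctor.Coalgebra (diagF n C ⋙ H ⋙ coprodF n C) where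
  obj V :=
    { V := (coprodF n C).obj V.V
      str := (coprodF n C).map V.str }
  map {V₀ V₁} f :=
    { f := (coprodF n C).map f.f
      h := by
        dsimp only [Functor.comp_obj, Functor.comp_map]
        rw [← Functor.map_comp, ← Functor.map_comp]
        congr 1
        exact f.h }
  map_id V := by
    apply Endofunctor.Coalgebra.Hom.ext
    simp
  map_comp f g := by
    apply Endofunctor.Coalgebra.Hom.ext
    simp

section CoproductFunctor

variable {n : ℕ}

/-- The `i`-th coproduct injection `Xᵢ ⟶ ∐X`. -/
def coprodι [HasFiniteCoproducts C] (X : Fin n → C) (i : Fin n) :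
    X i ⟶ (coprodF n C).obj X :=
  Sigma.ι X i

theorem coprodι_hom_ext [HasFiniteCoproducts C] {X : Fin n → C} {W : C}
    {f g : (coprodF n C).obj X ⟶ W}
    (h : ∀ i, coprodι X i ≫ f = coprodι X i ≫ g) : f = g :=
  Sigma.hom_ext f g h

theorem coprodι_map [HasFiniteCoproducts C] {X Y : Fin n → C} (f : X ⟶ Y) (i : Fin n) :
    coprodι X i ≫ (coprodF n C).map f = f i ≫ coprodι Y i :=
  Sigma.ι_map f i

variable [FinitaryExtensive C]

instance mono_coprodι (X : Fin n → C) (i : Fin n) : Mono (coprodι X i) :=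
  inferInstanceAs (Mono (Sigma.ι X i))

instance coprodF_faithful : (coprodF n C).Faithful where
  map_injective {X Y} f g h := by
    funext i
    rw [← cancel_mono (coprodι Y i), ← coprodι_map, ← coprodι_map, h]

/-- In an extensive category the naturality squares of the coproduct injections are pullbacks. -/
theorem isPullback_coprodι {X Y : Fin n → C} (f : X ⟶ Y) (i : Fin n) :
    IsPullback (coprodι X i) (f i) ((coprodF n C).map f) (coprodι Y i) :=
  (FinitaryExtensive.isVanKampen_finiteCoproducts
    (colimit.isColimit (Discrete.functor Y)) (colimit.cocone (Discrete.functor X))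
    (Discrete.natTrans fun j => f j.as) ((coprodF n C).map f)
    (by
      ext j
      exact (coprodι_map f j.as).symm)
    (NatTrans.Equifibered.of_discrete _)).mp ⟨colimit.isColimit _⟩ ⟨i⟩

/-- A morphism `∐X ⟶ ∐Y` lying over `∐Z` comes from a morphism `X ⟶ Y` over `Z`. -/
theorem exists_coprodF_map_eq {X Y Z : Fin n → C} (ζ : Y ⟶ Z) (k : X ⟶ Z)
    (g : (coprodF n C).obj X ⟶ (coprodF n C).obj Y)
    (w : g ≫ (coprodF n C).map ζ = (coprodF n C).map k) :
    ∃ h : X ⟶ Y, (coprodF n C).map h = g ∧ h ≫ ζ = k := by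
  have comm (i : Fin n) :
      (coprodι X i ≫ g) ≫ (coprodF n C).map ζ = k i ≫ coprodι Z i := by
    rw [Category.assoc, w, coprodι_map]
  refine ⟨fun i => (isPullback_coprodι ζ i).lift _ _ (comm i), ?_, ?_⟩
  · refine coprodι_hom_ext fun i => ?_
    rw [coprodι_map]
    exact (isPullback_coprodι ζ i).lift_fst _ _ (comm i)
  · funext i
    exact (isPullback_coprodι ζ i).lift_snd _ _ (comm i)

/-- In an extensive category every morphism into a coproduct `∐Z` is, up to isomorphism of its
domain, of the form `∐g`. -/
theorem exists_iso_hom_comp_eq_coprodF_map {W : C} {Z : Fin n → C}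
    (f : W ⟶ (coprodF n C).obj Z) :
    ∃ (Y : Fin n → C) (e : (coprodF n C).obj Y ≅ W) (g : Y ⟶ Z),
      e.hom ≫ f = (coprodF n C).map g := by
  have hpb (i : Fin n) : HasPullback f (coprodι Z i) :=
    FinitaryPreExtensive.hasPullbacks_of_is_coproduct
      (colimit.isColimit (Discrete.functor Z)) ⟨i⟩ f
  let Y : Fin n → C := fun i => pullback f (coprodι Z i)
  let g : Y ⟶ Z := fun i => pullback.snd f (coprodι Z i)
  let c : Cofan Y := Cofan.mk W fun i => pullback.fst f (coprodι Z i)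
  have hsq (i : Fin n) : IsPullback (pullback.fst f (coprodι Z i)) (g i) f (coprodι Z i) :=
    IsPullback.of_hasPullback _ _
  obtain ⟨hc⟩ := FinitaryPreExtensive.isUniversal_finiteCoproducts
    (colimit.isColimit (Discrete.functor Z)) c
    (Discrete.natTrans fun j => g j.as) f
    (by
      ext j
      exact (hsq j.as).w.symm)
    (NatTrans.Equifibered.of_discrete _)
    (fun j => hsq j.as)
  let e : (coprodF n C).obj Y ≅ W := (colimit.isColimit _).coconePointUniqueUpToIso hc
  have he (i : Fin n) : coprodι Y i ≫ e.hom = pullback.fst f (coprodι Z i) :=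
    (colimit.isColimit _).comp_coconePointUniqueUpToIso_hom hc ⟨i⟩
  refine ⟨Y, e, g, coprodι_hom_ext fun i => ?_⟩
  rw [coprodι_map, ← Category.assoc, he]
  exact pullback.condition

end CoproductFunctor

section Lifting

variable {n : ℕ} [FinitaryExtensive C] (H : (Fin n → C) ⥤ (Fin n → C))

instance liftCoprod_faithful : (liftCoprod n H).Faithful where
  map_injective h :=
    Endofunctor.Coalgebra.Hom.ext
      ((coprodF n C).map_injective (congrArg Endofunctor.Coalgebra.Hom.f h))

instance liftCoprod_full : (liftCoprod n H).Full where
  map_surjective {V₀ V₁} g := by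
    obtain ⟨h, hg, hs⟩ := exists_coprodF_map_eq V₁.str
      (V₀.str ≫ (diagF n C ⋙ H).map g.f) g.f
      (g.h.symm.trans ((coprodF n C).map_comp _ _).symm)
    refine ⟨{ f := h, h := ?_ }, Endofunctor.Coalgebra.Hom.ext hg⟩
    rw [hs, ← hg]
    rfl

instance liftCoprod_essSurj : (liftCoprod n H).EssSurj where
  mem_essImage W := by
    obtain ⟨Y, e, g, w⟩ := exists_iso_hom_comp_eq_coprodF_map W.str
    refine ⟨⟨Y, g ≫ (diagF n C ⋙ H).map e.inv⟩,
      ⟨Endofunctor.Coalgebra.isoMk e (Eq.trans ?_ w.symm)⟩⟩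
    change (coprodF n C).map (g ≫ (diagF n C ⋙ H).map e.inv) ≫
      (coprodF n C).map ((diagF n C ⋙ H).map e.hom) = _
    rw [← Functor.map_comp, Category.assoc, ← Functor.map_comp, e.inv_hom_id,
      CategoryTheory.Functor.map_id]
    exact congrArg (coprodF n C).map (Category.comp_id g)

end Lifting

/-- **De-sorting multisorted coalgebras.**  Let `C` be an extensive category with finite
coproducts and let `H : Cⁿ ⥤ Cⁿ` preserve monomorphisms.  Then the lifting of the
coproduct functor, from coalgebras for the endofunctor `H ∘ Δ ∘ ∐` of `Cⁿ` to coalgebras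
for the endofunctor `∐ ∘ H ∘ Δ` of `C`, sending `(X, ξ)` to `(∐X, ∐ξ)` and `h` to `∐h`,
is an equivalence of categories (full, faithful and essentially surjective). -/
theorem liftCoprod_isEquivalence (n : ℕ) [FinitaryExtensive C]
    (H : (Fin n → C) ⥤ (Fin n → C)) [H.PreservesMonomorphisms] :
    (liftCoprod n H).IsEquivalence := by
  exact {}

end
end
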